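/- Let α, β > 0, K, K_g, E₁, E₂ ≥ 0, C̃ > 0, T > 0, and let ρ : [0,T] → [0,∞) be continuous. Let u, ω, g : ℝ³×[0,T] → ℝ³ and σ : ℝ³×[0,T] → M₃(ℝ) be smooth and ℤ³-periodic in space, with ω = ∇×u, ∇·u = 0, ∇·(Ju) = 0, satisfying pointwise the regularized vorticity equation ∂ₜω − αΔω + (Ju·∇)ω + Ω(Ju,u) = β(∇×div Jσ) + g. Assume: (i) |(∇×div Jσ)(x,t)| ≤ 3K ‖σ(·,t)‖_{L²} for all (x,t); (ii) ‖σ(·,t)‖²_{L²} ≤ ρ(t) for all t; (iii) ‖Ω(Ju,u)(·,t)‖²_{L²} ≤ 81 K (E₁t + E₂) C̃ ‖ω(·,t)‖²_{L²} for all t; (iv) |g(x,t)| ≤ K_g for all (x,t). Then for all t ∈ [0,T], ‖ω(·,t)‖²_{L²} ≤ e^{(β + 4 + 162KE₂C̃)t + 81KE₁C̃t²} ( ‖ω(·,0)‖²_{L²} + 2K_g² t + 9K²β ∫₀ᵗ ρ(s) ds ). -/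

import Mathlib

open MeasureTheory

noncomputable section

abbrev V3 := Fin 3 → ℝ

/-- spatial partial derivative ∂ᵢf -/
def pd (i : Fin 3) (f : V3 → ℝ) (x : V3) : ℝ := fderiv ℝ f x (Pi.single i 1)

/-- Laplacian of a scalar function -/
def lap (f : V3 → ℝ) (x : V3) : ℝ := ∑ i, pd i (pd i f) x

/-- ℤ³-periodicity -/
def Periodic3 (f : V3 → ℝ) : Prop :=
  ∀ (x : V3) (k : Fin 3 → ℤ), f (x + fun i => (k i : ℝ)) = f x

/-- mollification Jf = η ∗ f -/
def J3 (η f : V3 → ℝ) (x : V3) : ℝ := ∫ y, η (x - y) * f y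

/-- curl ∇×u -/
def curl3 (u : V3 → V3) (x : V3) : V3 :=
  ![pd 1 (fun y => u y 2) x - pd 2 (fun y => u y 1) x,
    pd 2 (fun y => u y 0) x - pd 0 (fun y => u y 2) x,
    pd 0 (fun y => u y 1) x - pd 1 (fun y => u y 0) x]

/-- (v·∇)u -/
def advect (v u : V3 → V3) (x : V3) : V3 :=
  fun i => ∑ j, v x j * pd j (fun y => u y i) x

/-- the bilinear term Ω(v,u) -/
def Omg (v u : V3 → V3) (x : V3) : V3 :=
  ![∑ j, (pd 1 (fun y => v y j) x * pd j (fun y => u y 2) x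
      - pd 2 (fun y => v y j) x * pd j (fun y => u y 1) x),
    ∑ j, (pd 2 (fun y => v y j) x * pd j (fun y => u y 0) x
      - pd 0 (fun y => v y j) x * pd j (fun y => u y 2) x),
    ∑ j, (pd 0 (fun y => v y j) x * pd j (fun y => u y 1) x
      - pd 1 (fun y => v y j) x * pd j (fun y => u y 0) x)]

/-- the mollified velocity field Ju(·,t) -/
def Jvec (η : V3 → ℝ) (u : V3 → ℝ → V3) (t : ℝ) : V3 → V3 :=
  fun y i => J3 η (fun z => u z t i) y

/-- the vector field div(Jσ)(·,t) -/
def divJσ (η : V3 → ℝ) (σ : V3 → ℝ → Matrix (Fin 3) (Fin 3) ℝ) (t : ℝ) : V3 → V3 :=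
  fun y i => ∑ j, pd j (J3 η (fun z => σ z t i j)) y

theorem ContDiff.pd_of_top {f : V3 → ℝ} (hf : ContDiff ℝ (⊤ : ℕ∞) f) (i : Fin 3) :
    ContDiff ℝ (⊤ : ℕ∞) (pd i f) :=
  (hf.fderiv_right (m := (⊤ : ℕ∞)) (by simp)).clm_apply contDiff_const

theorem pd_mul {f g : V3 → ℝ} {x : V3} (hf : DifferentiableAt ℝ f x)
    (hg : DifferentiableAt ℝ g x) (i : Fin 3) :
    pd i (fun y => f y * g y) x = f x * pd i g x + g x * pd i f x := by
  simp [pd, fderiv_fun_mul hf hg]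

theorem Periodic3.mul {f g : V3 → ℝ} (hf : Periodic3 f) (hg : Periodic3 g) :
    Periodic3 (fun x => f x * g x) := fun x k => by
  simp only [hf x k, hg x k]

theorem Periodic3.pd {f : V3 → ℝ} (hf : Periodic3 f) (i : Fin 3) : Periodic3 (pd i f) := by
  intro x k
  have h : (fun y => f (y + fun i => (k i : ℝ))) = f := funext fun y => hf y k
  unfold _root_.pd
  rw [← fderiv_comp_add_right, h]

theorem Periodic3.J3 (η : V3 → ℝ) {f : V3 → ℝ} (hf : Periodic3 f) : Periodic3 (J3 η f) := by
  intro x k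
  unfold _root_.J3
  have h := integral_add_right_eq_self (μ := volume)
    (fun y => η (x + (fun i => (k i : ℝ)) - y) * f y) (fun i => (k i : ℝ))
  have hk : ∀ y, f (y + fun i => (k i : ℝ)) = f y := fun y => hf y k
  simpa only [hk, add_sub_add_right_eq_sub] using h.symm

theorem contDiff_J3 {η f : V3 → ℝ} (hη : ContDiff ℝ (⊤ : ℕ∞) η) (hηs : HasCompactSupport η)
    (hf : Continuous f) : ContDiff ℝ (⊤ : ℕ∞) (J3 η f) := by
  have h := hηs.contDiff_convolution_right (ContinuousLinearMap.mul ℝ ℝ)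
    (hf.locallyIntegrable (μ := volume)) hη
  have heq : J3 η f = convolution f η (ContinuousLinearMap.mul ℝ ℝ) volume :=
    funext fun x => integral_congr_ae (.of_forall fun y => mul_comm _ _)
  rwa [heq]

/-- The integral of the divergence of a periodic vector field over a period cell vanishes. -/
theorem integral_div_eq_zero_of_periodic {F : Fin 3 → V3 → ℝ}
    (hF : ∀ i, ContDiff ℝ (⊤ : ℕ∞) (F i)) (hper : ∀ i, Periodic3 (F i)) :
    ∫ x in Set.Icc (0 : V3) 1, ∑ i, pd i (F i) x = 0 := by
  have hc : Continuous fun x => ∑ i, pd i (F i) x :=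
    continuous_finsetSum _ fun i _ => ((hF i).pd_of_top i).continuous
  refine (integral_divergence_of_hasFDerivAt_off_countable' (0 : V3) 1 zero_le_one F
    (fun i => fderiv ℝ (F i)) ∅ Set.countable_empty (fun i => (hF i).continuous.continuousOn)
    (fun x _ i => ((hF i).differentiable (by simp) x).hasFDerivAt)
    (hc.continuousOn.integrableOn_compact isCompact_Icc)).trans ?_
  refine Finset.sum_eq_zero fun i _ => sub_eq_zero.2 ?_
  refine integral_congr_ae (.of_forall fun x => ?_)
  have h : (i.insertNth ((1 : V3) i) x : V3)
      = (i.insertNth ((0 : V3) i) x : V3) + fun j => ((Pi.single i (1 : ℤ) : Fin 3 → ℤ) j : ℝ) := by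
    ext j
    refine Fin.succAboveCases i ?_ (fun j => ?_) j <;> simp
  simp only [h]
  exact hper i _ _

theorem integral_mul_lap_nonpos {w : V3 → ℝ} (hw : ContDiff ℝ (⊤ : ℕ∞) w) (hper : Periodic3 w) :
    ∫ x in Set.Icc (0 : V3) 1, w x * lap w x ≤ 0 := by
  have hd := integral_div_eq_zero_of_periodic (F := fun i x => w x * pd i w x)
    (fun i => hw.mul (hw.pd_of_top i)) (fun i => hper.mul (hper.pd i))
  have hle : ∀ x, w x * lap w x ≤ ∑ i, pd i (fun x => w x * pd i w x) x := by
    intro x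
    rw [lap, Finset.mul_sum]
    refine Finset.sum_le_sum fun i _ => ?_
    rw [pd_mul (hw.differentiable (by simp) x) ((hw.pd_of_top i).differentiable (by simp) x)]
    nlinarith [mul_self_nonneg (pd i w x)]
  rw [← hd]
  refine setIntegral_mono ?_ ?_ hle
  · refine Continuous.integrableOn_Icc (hw.continuous.mul ?_)
    exact continuous_finsetSum _ fun i _ => ((hw.pd_of_top i).pd_of_top i).continuous
  · refine Continuous.integrableOn_Icc ?_
    exact continuous_finsetSum _ fun i _ => ((hw.mul (hw.pd_of_top i)).pd_of_top i).continuous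

theorem integral_mul_transport_eq_zero {w : V3 → ℝ} {v : V3 → V3}
    (hw : ContDiff ℝ (⊤ : ℕ∞) w) (hwper : Periodic3 w)
    (hv : ∀ i, ContDiff ℝ (⊤ : ℕ∞) fun x => v x i) (hvper : ∀ i, Periodic3 fun x => v x i)
    (hdiv : ∀ x, ∑ i, pd i (fun y => v y i) x = 0) :
    ∫ x in Set.Icc (0 : V3) 1, w x * ∑ j, v x j * pd j w x = 0 := by
  have hd := integral_div_eq_zero_of_periodic (F := fun i x => v x i * (w x * w x))
    (fun i => (hv i).mul (hw.mul hw)) (fun i => (hvper i).mul (hwper.mul hwper))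
  have heq : ∀ x, ∑ i, pd i (fun x => v x i * (w x * w x)) x
      = 2 * (w x * ∑ j, v x j * pd j w x) := by
    intro x
    have hwx := hw.differentiable (by simp) x
    have h : ∀ i, pd i (fun x => v x i * (w x * w x)) x
        = 2 * (w x * (v x i * pd i w x)) + w x * w x * pd i (fun y => v y i) x := by
      intro i
      rw [pd_mul ((hv i).differentiable (by simp) x) (hwx.fun_mul hwx), pd_mul hwx hwx]
      ring
    simp only [h, Finset.sum_add_distrib, ← Finset.mul_sum, hdiv, mul_zero, add_zero]
  simp only [heq, integral_const_mul] at hd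
  linarith

/-- Differentiation under the integral sign over a compact set. -/
theorem hasDerivAt_setIntegral_of_contDiff {G : V3 × ℝ → ℝ} (hG : ContDiff ℝ 1 G)
    {s : Set V3} (hs : IsCompact s) (t : ℝ) :
    IntegrableOn (fun x => deriv (fun r => G (x, r)) t) s ∧
      HasDerivAt (fun r => ∫ x in s, G (x, r)) (∫ x in s, deriv (fun r => G (x, r)) t) t := by
  have hd : ∀ x r, HasDerivAt (fun r => G (x, r)) (fderiv ℝ G (x, r) (0, 1)) r := fun x r =>
    ((hG.differentiable (by simp) (x, r)).hasFDerivAt).comp_hasDerivAt r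
      ((hasDerivAt_const r x).prodMk (hasDerivAt_id r))
  have hc : Continuous fun q : V3 × ℝ => fderiv ℝ G q (0, 1) :=
    (hG.continuous_fderiv (by simp)).clm_apply continuous_const
  obtain ⟨C, hC⟩ := (hs.prod (isCompact_Icc (a := t - 1) (b := t + 1))).exists_bound_of_continuousOn
    hc.continuousOn
  simp only [(hd _ _).deriv]
  refine hasDerivAt_integral_of_dominated_loc_of_deriv_le (s := Set.Icc (t - 1) (t + 1))
    (F := fun r x => G (x, r)) (F' := fun r x => fderiv ℝ G (x, r) (0, 1)) (bound := fun _ => C)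
    (Icc_mem_nhds (by linarith) (by linarith)) (.of_forall fun r => ?_) ?_ ?_ ?_ ?_ ?_
  · exact (hG.continuous.comp (Continuous.prodMk_left r)).aestronglyMeasurable
  · exact (hG.continuous.comp (Continuous.prodMk_left t)).continuousOn.integrableOn_compact hs
  · exact (hc.comp (Continuous.prodMk_left t)).aestronglyMeasurable
  · exact ae_restrict_of_forall_mem hs.measurableSet fun x hx r hr => hC (x, r) ⟨hx, hr⟩
  · exact integrableOn_const hs.measure_lt_top.ne
  · exact .of_forall fun x r _ => hd x r

/-- Grönwall's inequality with affine growth rate and a nonnegative forcing term. -/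
theorem gronwall_affine {y y' f : ℝ → ℝ} {a b T : ℝ} (ha : 0 ≤ a) (hb : 0 ≤ b)
    (hy : ∀ t, HasDerivAt y (y' t) t) (hf : ContinuousOn f (Set.Icc 0 T))
    (hf0 : ∀ t ∈ Set.Icc 0 T, 0 ≤ f t)
    (hle : ∀ t ∈ Set.Ioo 0 T, y' t ≤ (a + b * t) * y t + f t) :
    ∀ t ∈ Set.Icc 0 T, y t ≤ Real.exp (a * t + b / 2 * t ^ 2) * (y 0 + ∫ s in (0 : ℝ)..t, f s) := by
  intro t ht
  have hT : 0 ≤ T := ht.1.trans ht.2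
  set z : ℝ → ℝ := fun t => Real.exp (-(a * t + b / 2 * t ^ 2)) * y t - ∫ s in (0 : ℝ)..t, f s
    with hz
  have hfi : ContinuousOn (fun t => ∫ s in (0 : ℝ)..t, f s) (Set.Icc 0 T) := by
    have h := intervalIntegral.continuousOn_primitive_interval (μ := volume) (f := f) (a := 0)
      (b := T) (by rw [Set.uIcc_of_le hT]; exact hf.integrableOn_Icc)
    rwa [Set.uIcc_of_le hT] at h
  have hyc : Continuous y := continuous_iff_continuousAt.2 fun t => (hy t).continuousAt
  have hzd : ∀ t ∈ Set.Ioo 0 T, HasDerivAt z (Real.exp (-(a * t + b / 2 * t ^ 2)) *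
      (y' t - (a + b * t) * y t) - f t) t := by
    intro t ht
    have h1 : HasDerivAt (fun t : ℝ => -(a * t + b / 2 * t ^ 2)) (-(a + b * t)) t := by
      refine ((((hasDerivAt_id t).const_mul a).add
        ((hasDerivAt_pow 2 t).const_mul (b / 2))).neg).congr_deriv ?_
      simp; ring
    have h2 : HasDerivAt (fun t => ∫ s in (0 : ℝ)..t, f s) (f t) t := by
      refine intervalIntegral.integral_hasDerivAt_right ?_ ?_
        (hf.continuousAt (Icc_mem_nhds ht.1 ht.2))
      · refine ContinuousOn.intervalIntegrable ?_
        rw [Set.uIcc_of_le ht.1.le]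
        exact hf.mono (Set.Icc_subset_Icc_right ht.2.le)
      · exact (hf.mono Set.Ioo_subset_Icc_self).stronglyMeasurableAtFilter isOpen_Ioo t ht
    refine ((h1.exp.mul (hy t)).sub h2).congr_deriv ?_
    ring
  have hanti : AntitoneOn z (Set.Icc 0 T) := by
    refine antitoneOn_of_deriv_nonpos (convex_Icc 0 T) ?_ ?_ ?_
    · exact (Continuous.continuousOn (by fun_prop)).sub hfi
    · rw [interior_Icc]
      exact fun t ht => (hzd t ht).differentiableAt.differentiableWithinAt
    · rw [interior_Icc]
      intro t ht
      rw [(hzd t ht).deriv]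
      have h0 := hf0 t (Set.Ioo_subset_Icc_self ht)
      have he : Real.exp (-(a * t + b / 2 * t ^ 2)) ≤ 1 := by
        rw [Real.exp_le_one_iff]
        have := ht.1
        have : 0 ≤ a * t + b / 2 * t ^ 2 := by positivity
        linarith
      have h3 : y' t - (a + b * t) * y t ≤ f t := by linarith [hle t ht]
      have h4 := mul_le_mul_of_nonneg_left h3 (Real.exp_pos (-(a * t + b / 2 * t ^ 2))).le
      nlinarith
  have h := hanti ⟨le_rfl, hT⟩ ht ht.1
  simp only [hz, intervalIntegral.integral_same, Real.exp_neg] at h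
  norm_num at h
  have hE := Real.exp_pos (a * t + b / 2 * t ^ 2)
  rw [inv_mul_eq_div, div_le_iff₀ hE] at h
  linarith

theorem continuous_Omg {v u : V3 → V3} (hv : ∀ i, ContDiff ℝ (⊤ : ℕ∞) fun x => v x i)
    (hu : ∀ i, ContDiff ℝ (⊤ : ℕ∞) fun x => u x i) (i : Fin 3) :
    Continuous fun x => Omg v u x i := by
  have h : ∀ k j l, Continuous fun x => pd k (fun y => v y j) x * pd j (fun y => u y l) x :=
    fun k j l => ((hv j).pd_of_top k).continuous.mul ((hu l).pd_of_top j).continuous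
  fin_cases i
  · exact continuous_finsetSum Finset.univ fun j _ => (h 1 j 2).sub (h 2 j 1)
  · exact continuous_finsetSum Finset.univ fun j _ => (h 2 j 0).sub (h 0 j 2)
  · exact continuous_finsetSum Finset.univ fun j _ => (h 0 j 1).sub (h 1 j 0)

/-- L² a priori estimate for the vorticity. -/
theorem vorticity_L2_apriori (α β K K_g E₁ E₂ Ct T : ℝ)
    (hα : 0 < α) (hβ : 0 < β) (hK : 0 ≤ K) (hKg : 0 ≤ K_g)
    (hE₁ : 0 ≤ E₁) (hE₂ : 0 ≤ E₂) (hCt : 0 < Ct) (hT : 0 < T)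
    (ρ : ℝ → ℝ) (hρc : ContinuousOn ρ (Set.Icc (0:ℝ) T))
    (hρ0 : ∀ t ∈ Set.Icc (0:ℝ) T, 0 ≤ ρ t)
    (η : V3 → ℝ) (hη : ContDiff ℝ (⊤:ℕ∞) η) (hηsupp : HasCompactSupport η)
    (hηeven : ∀ x : V3, η (-x) = η x) (hηint : (∫ x : V3, η x) = 1)
    (u ω g : V3 → ℝ → V3) (σ : V3 → ℝ → Matrix (Fin 3) (Fin 3) ℝ)
    (hu : ∀ i, ContDiff ℝ (⊤:ℕ∞) (fun q : V3 × ℝ => u q.1 q.2 i))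
    (hω : ∀ i, ContDiff ℝ (⊤:ℕ∞) (fun q : V3 × ℝ => ω q.1 q.2 i))
    (hg : ∀ i, ContDiff ℝ (⊤:ℕ∞) (fun q : V3 × ℝ => g q.1 q.2 i))
    (hσ : ∀ i j, ContDiff ℝ (⊤:ℕ∞) (fun q : V3 × ℝ => σ q.1 q.2 i j))
    (huper : ∀ t i, Periodic3 (fun x => u x t i))
    (hωper : ∀ t i, Periodic3 (fun x => ω x t i))
    (hgper : ∀ t i, Periodic3 (fun x => g x t i))
    (hσper : ∀ t i j, Periodic3 (fun x => σ x t i j))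
    (hcurl : ∀ (x : V3) (t : ℝ), ω x t = curl3 (fun y => u y t) x)
    (hdiv : ∀ (x : V3) (t : ℝ), (∑ i, pd i (fun y => u y t i) x) = 0)
    (hdivJ : ∀ (x : V3) (t : ℝ), (∑ i, pd i (fun y => Jvec η u t y i) x) = 0)
    (hpde : ∀ x : V3, ∀ t ∈ Set.Icc (0:ℝ) T, ∀ i,
      HasDerivWithinAt (fun s => ω x s i)
        (α * lap (fun y => ω y t i) x
          - (∑ j, Jvec η u t x j * pd j (fun y => ω y t i) x)
          - Omg (Jvec η u t) (fun y => u y t) x i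
          + β * curl3 (divJσ η σ t) x i
          + g x t i)
        (Set.Icc (0:ℝ) T) t)
    -- (i): pointwise bound on ∇×div Jσ
    (hi : ∀ x : V3, ∀ t ∈ Set.Icc (0:ℝ) T,
      Real.sqrt (∑ i, (curl3 (divJσ η σ t) x i)^2)
        ≤ 3 * K * Real.sqrt (∫ y in Set.Icc (0:V3) 1, ∑ i, ∑ j, (σ y t i j)^2))
    -- (ii): L² bound on σ
    (hii : ∀ t ∈ Set.Icc (0:ℝ) T,
      (∫ y in Set.Icc (0:V3) 1, ∑ i, ∑ j, (σ y t i j)^2) ≤ ρ t)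
    -- (iii): L² bound on Ω(Ju,u)
    (hiii : ∀ t ∈ Set.Icc (0:ℝ) T,
      (∫ x in Set.Icc (0:V3) 1, ∑ i, (Omg (Jvec η u t) (fun y => u y t) x i)^2)
        ≤ 81 * K * (E₁ * t + E₂) * Ct
          * ∫ x in Set.Icc (0:V3) 1, ∑ i, (ω x t i)^2)
    -- (iv): pointwise bound on g
    (hiv : ∀ x : V3, ∀ t ∈ Set.Icc (0:ℝ) T,
      Real.sqrt (∑ i, (g x t i)^2) ≤ K_g) :
    ∀ t ∈ Set.Icc (0:ℝ) T,
      (∫ x in Set.Icc (0:V3) 1, ∑ i, (ω x t i)^2)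
        ≤ Real.exp ((β + 4 + 162*K*E₂*Ct) * t + 81*K*E₁*Ct*t^2)
          * ((∫ x in Set.Icc (0:V3) 1, ∑ i, (ω x 0 i)^2)
             + 2*K_g^2*t
             + 9*K^2*β * ∫ s in (0:ℝ)..t, ρ s) := by
  have hslice : ∀ {h : V3 → ℝ → V3},
      (∀ i, ContDiff ℝ (⊤:ℕ∞) (fun q : V3 × ℝ => h q.1 q.2 i)) →
      ∀ t i, ContDiff ℝ (⊤:ℕ∞) (fun x => h x t i) := fun hh t i =>
    (hh i).comp (contDiff_id.prodMk contDiff_const)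
  have hω' := hslice hω
  have hu' := hslice hu
  have hJ : ∀ t i, ContDiff ℝ (⊤:ℕ∞) (fun x => Jvec η u t x i) := fun t i =>
    contDiff_J3 hη hηsupp (hu' t i).continuous
  have hJper : ∀ t i, Periodic3 (fun x => Jvec η u t x i) := fun t i => (huper t i).J3 η
  have hG : ContDiff ℝ 1 (fun q : V3 × ℝ => ∑ i, (ω q.1 q.2 i)^2) :=
    ContDiff.sum fun i _ => ((hω i).of_le (by simp)).pow 2
  have hder := hasDerivAt_setIntegral_of_contDiff hG (isCompact_Icc (a := (0:V3)) (b := 1))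
  have hσρ : ∀ x, ∀ t ∈ Set.Icc (0:ℝ) T,
      ∑ i, (curl3 (divJσ η σ t) x i)^2 ≤ 9 * K^2 * ρ t := by
    intro x t ht
    have h := (Real.sqrt_le_left (by positivity)).1
      ((hi x t ht).trans (mul_le_mul_of_nonneg_left (Real.sqrt_le_sqrt (hii t ht)) (by positivity)))
    rwa [mul_pow, Real.sq_sqrt (hρ0 t ht), mul_pow, show (3:ℝ)^2 = 9 by norm_num] at h
  have hineq : ∀ t ∈ Set.Ioo (0:ℝ) T,
      (∫ x in Set.Icc (0:V3) 1, deriv (fun r => ∑ i, (ω x r i)^2) t)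
        ≤ ((β + 2 + 81*K*E₂*Ct) + 81*K*E₁*Ct * t) * (∫ x in Set.Icc (0:V3) 1, ∑ i, (ω x t i)^2)
          + (K_g^2 + 9*K^2*β * ρ t) := by
    intro t ht
    have ht' := Set.Ioo_subset_Icc_self ht
    have hpoint : ∀ x, deriv (fun r => ∑ i, (ω x r i)^2) t
        ≤ ∑ i, (2*α * (ω x t i * lap (fun y => ω y t i) x)
            - 2 * (ω x t i * ∑ j, Jvec η u t x j * pd j (fun y => ω y t i) x))
          + ((2 + β) * (∑ i, (ω x t i)^2)
            + ∑ i, (Omg (Jvec η u t) (fun y => u y t) x i)^2 + (K_g^2 + 9*K^2*β * ρ t)) := by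
      intro x
      have hd := HasDerivAt.fun_sum (u := Finset.univ) fun i _ =>
        (((hpde x t ht' i).hasDerivAt (Icc_mem_nhds ht.1 ht.2)).fun_pow 2)
      rw [hd.deriv]
      have h1 := mul_le_mul_of_nonneg_left (hσρ x t ht') hβ.le
      have h2 := (Real.sqrt_le_left hKg).1 (hiv x t ht')
      have h3 : ∀ w L A O F g : ℝ, 2 * w * (α * L - A - O + β * F + g)
          ≤ (2*α * (w * L) - 2 * (w * A)) + ((2 + β) * w^2 + O^2 + (β * F^2 + g^2)) := by
        intro w L A O F g
        nlinarith [sq_nonneg (w + O), sq_nonneg (w - g), mul_nonneg hβ.le (sq_nonneg (w - F))]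
      have h4 := Finset.sum_le_sum fun i (_ : i ∈ Finset.univ) =>
        h3 (ω x t i) (lap (fun y => ω y t i) x) (∑ j, Jvec η u t x j * pd j (fun y => ω y t i) x)
          (Omg (Jvec η u t) (fun y => u y t) x i) (curl3 (divJσ η σ t) x i) (g x t i)
      simp only [Finset.sum_add_distrib (ι := Fin 3), ← Finset.mul_sum (ι := Fin 3)] at h4 ⊢
      norm_num at h4 ⊢
      linarith
    have hPi : ∀ i, IntegrableOn (fun x => ω x t i * lap (fun y => ω y t i) x)
        (Set.Icc (0:V3) 1) := fun i => Continuous.integrableOn_Icc <|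
      (hω' t i).continuous.mul <| continuous_finsetSum _ fun j _ =>
        (((hω' t i).pd_of_top j).pd_of_top j).continuous
    have hQi : ∀ i, IntegrableOn
        (fun x => ω x t i * ∑ j, Jvec η u t x j * pd j (fun y => ω y t i) x)
        (Set.Icc (0:V3) 1) := fun i => Continuous.integrableOn_Icc <|
      (hω' t i).continuous.mul <| continuous_finsetSum _ fun j _ =>
        (hJ t j).continuous.mul ((hω' t i).pd_of_top j).continuous
    have hWi : IntegrableOn (fun x => ∑ i, (ω x t i)^2) (Set.Icc (0:V3) 1) :=
      Continuous.integrableOn_Icc <| continuous_finsetSum _ fun i _ =>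
        (hω' t i).continuous.pow 2
    have hOi : IntegrableOn (fun x => ∑ i, (Omg (Jvec η u t) (fun y => u y t) x i)^2)
        (Set.Icc (0:V3) 1) :=
      Continuous.integrableOn_Icc <| continuous_finsetSum _ fun i _ =>
        (continuous_Omg (hJ t) (hu' t) i).pow 2
    have hCi : IntegrableOn (fun _ => K_g^2 + 9*K^2*β * ρ t) (Set.Icc (0:V3) 1) :=
      Continuous.integrableOn_Icc continuous_const
    have hPQi : ∀ i, IntegrableOn (fun x => 2*α * (ω x t i * lap (fun y => ω y t i) x)
        - 2 * (ω x t i * ∑ j, Jvec η u t x j * pd j (fun y => ω y t i) x)) (Set.Icc (0:V3) 1) :=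
      fun i => ((hPi i).const_mul (2*α)).sub ((hQi i).const_mul 2)
    have hSi := integrable_finsetSum Finset.univ fun i _ => hPQi i
    have hRi := ((hWi.const_mul (2 + β)).fun_add hOi).fun_add hCi
    refine (integral_mono (hder t).1 (hSi.fun_add hRi) hpoint).trans ?_
    have hS : ∫ x in Set.Icc (0:V3) 1, ∑ i, (2*α * (ω x t i * lap (fun y => ω y t i) x)
        - 2 * (ω x t i * ∑ j, Jvec η u t x j * pd j (fun y => ω y t i) x)) ≤ 0 := by
      rw [integral_finsetSum _ fun i _ => hPQi i]
      refine Finset.sum_nonpos fun i _ => ?_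
      rw [integral_sub ((hPi i).const_mul _) ((hQi i).const_mul _), integral_const_mul,
        integral_const_mul, integral_mul_transport_eq_zero (hω' t i) (hωper t i) (hJ t) (hJper t)
          fun x => hdivJ x t]
      have := mul_nonpos_of_nonneg_of_nonpos (by positivity : 0 ≤ 2*α)
        (integral_mul_lap_nonpos (hω' t i) (hωper t i))
      linarith
    have hvol : (volume : Measure V3).real (Set.Icc 0 1) = 1 := by
      simp [Measure.real, Real.volume_Icc_pi]
    rw [integral_add hSi hRi, integral_add ((hWi.const_mul (2 + β)).fun_add hOi) hCi,
      integral_add (hWi.const_mul (2 + β)) hOi, integral_const_mul, setIntegral_const, hvol,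
      one_smul]
    linarith [hiii t ht']
  intro t ht
  have hgron := gronwall_affine (a := β + 2 + 81*K*E₂*Ct) (b := 81*K*E₁*Ct) (by positivity)
    (by positivity) (fun t => (hder t).2) (f := fun t => K_g^2 + 9*K^2*β * ρ t)
    (continuousOn_const.add (continuousOn_const.mul hρc))
    (fun t ht => by have := hρ0 t ht; positivity) hineq t ht
  have hρi : IntervalIntegrable ρ volume 0 t := by
    refine ContinuousOn.intervalIntegrable ?_
    rw [Set.uIcc_of_le ht.1]
    exact hρc.mono (Set.Icc_subset_Icc_right ht.2)
  have hρint : 0 ≤ ∫ s in (0:ℝ)..t, ρ s :=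
    intervalIntegral.integral_nonneg ht.1 fun s hs => hρ0 s ⟨hs.1, hs.2.trans ht.2⟩
  have hy0 : 0 ≤ ∫ x in Set.Icc (0:V3) 1, ∑ i, (ω x 0 i)^2 :=
    integral_nonneg fun x => Finset.sum_nonneg fun i _ => sq_nonneg _
  have ht0 := ht.1
  rw [intervalIntegral.integral_add (by simp) (hρi.const_mul _),
    intervalIntegral.integral_const, intervalIntegral.integral_const_mul] at hgron
  refine hgron.trans (mul_le_mul (Real.exp_le_exp.2 ?_) ?_ (by positivity) (Real.exp_pos _).le)
  · have h1 : 0 ≤ K*E₂*Ct * t := by positivity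
    have h2 : 0 ≤ K*E₁*Ct * t^2 := by positivity
    linarith
  · have h1 : 0 ≤ K_g^2 * t := by positivity
    simp only [sub_zero, smul_eq_mul]
    linarith
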